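/- Let m ≥ 1 be an integer, 0 < R₁ < R₂, τ > 0, and 0 < d < R₁. Then ∫_{−∞}^{∞} B_m(r) · sin(d r)/(r² + τ²) dr = π · b_m(τ) · sinh(dτ). -/

import Mathlib

open MeasureTheory

noncomputable section

/-- `B_m(z) = ∫_{R₁}^{R₂} s (R₂² − s²)^m (R₁² − s²)^m sin(z s) ds`. -/
def Bfun (m : ℕ) (R₁ R₂ z : ℝ) : ℝ :=
  ∫ s in R₁..R₂, s * (R₂ ^ 2 - s ^ 2) ^ m * (R₁ ^ 2 - s ^ 2) ^ m * Real.sin (z * s)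

/-- `b_m(t) = (1/t) ∫_{R₁}^{R₂} s (R₂² − s²)^m (R₁² − s²)^m e^{−st} ds`. -/
def bCoef (m : ℕ) (R₁ R₂ t : ℝ) : ℝ :=
  (1 / t) * ∫ s in R₁..R₂,
    s * (R₂ ^ 2 - s ^ 2) ^ m * (R₁ ^ 2 - s ^ 2) ^ m * Real.exp (-(s * t))

theorem integrable_inv_sq_add_sq {τ : ℝ} (hτ : 0 < τ) :
    Integrable fun r : ℝ => (r ^ 2 + τ ^ 2)⁻¹ := by
  have h := ((integrable_inv_one_add_sq.comp_div hτ.ne').const_mul (τ ^ 2)⁻¹)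
  refine h.congr (Filter.Eventually.of_forall fun r => ?_)
  have : r ^ 2 + τ ^ 2 ≠ 0 := by positivity
  simp only
  field_simp
  ring

theorem integrable_cos_mul_div_sq_add_sq {τ : ℝ} (hτ : 0 < τ) (a : ℝ) :
    Integrable fun r : ℝ => Real.cos (a * r) / (r ^ 2 + τ ^ 2) := by
  refine (integrable_inv_sq_add_sq hτ).mono' ?_ (Filter.Eventually.of_forall fun r => ?_)
  · exact (Measurable.aestronglyMeasurable (by fun_prop))
  · have h : 0 < r ^ 2 + τ ^ 2 := by positivity
    rw [Real.norm_eq_abs, abs_div, abs_of_pos h, div_eq_mul_inv]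
    exact mul_le_of_le_one_left (by positivity) (Real.abs_cos_le_one _)

theorem integrable_exp_neg_mul_abs {c : ℝ} (hc : 0 < c) :
    Integrable fun x : ℝ => (Real.exp (-(c * |x|)) : ℂ) := by
  suffices h : Integrable fun x : ℝ => Real.exp (-(c * |x|)) from h.ofReal
  rw [← integrableOn_univ, ← Set.Iic_union_Ioi (a := (0 : ℝ))]
  refine IntegrableOn.union ?_ ?_
  · refine (integrableOn_exp_mul_Iic hc 0).congr_fun (fun x hx => ?_) measurableSet_Iic
    simp only [abs_of_nonpos (Set.mem_Iic.1 hx), mul_neg, neg_neg]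
  · refine (integrableOn_exp_mul_Ioi (neg_lt_zero.2 hc) 0).congr_fun (fun x hx => ?_)
      measurableSet_Ioi
    simp only [abs_of_pos (Set.mem_Ioi.1 hx), neg_mul]

open FourierTransform in
theorem fourier_exp_neg_mul_abs {τ : ℝ} (hτ : 0 < τ) (r : ℝ) :
    𝓕 (fun x : ℝ => (Real.exp (-(2 * Real.pi * τ * |x|)) : ℂ)) r
      = ((τ / (Real.pi * (r ^ 2 + τ ^ 2)) : ℝ) : ℂ) := by
  have hpi := Real.pi_pos
  have hint := integrable_exp_neg_mul_abs (c := 2 * Real.pi * τ) (by positivity)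
  have hint' : Integrable fun x : ℝ => Complex.exp (↑(-2 * Real.pi * x * r) * Complex.I) •
      (Real.exp (-(2 * Real.pi * τ * |x|)) : ℂ) := by
    refine hint.norm.mono' (Continuous.aestronglyMeasurable (by fun_prop))
      (Filter.Eventually.of_forall fun x => ?_)
    rw [norm_smul, Complex.norm_exp_ofReal_mul_I, one_mul]
  rw [Real.fourier_real_eq_integral_exp_smul,
    ← intervalIntegral.integral_Iic_add_Ioi hint'.integrableOn hint'.integrableOn (b := 0)]
  have h1 : ∫ x in Set.Iic (0 : ℝ), Complex.exp (↑(-2 * Real.pi * x * r) * Complex.I) •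
      (Real.exp (-(2 * Real.pi * τ * |x|)) : ℂ)
      = ∫ x in Set.Iic (0 : ℝ), Complex.exp ((2 * Real.pi * (τ - r * Complex.I) : ℂ) * x) := by
    refine setIntegral_congr_fun measurableSet_Iic fun x hx => ?_
    simp only [abs_of_nonpos (Set.mem_Iic.1 hx), smul_eq_mul, Complex.ofReal_exp]
    rw [← Complex.exp_add]
    congr 1
    push_cast
    ring
  have h2 : ∫ x in Set.Ioi (0 : ℝ), Complex.exp (↑(-2 * Real.pi * x * r) * Complex.I) •
      (Real.exp (-(2 * Real.pi * τ * |x|)) : ℂ)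
      = ∫ x in Set.Ioi (0 : ℝ), Complex.exp ((-(2 * Real.pi * (τ + r * Complex.I)) : ℂ) * x) := by
    refine setIntegral_congr_fun measurableSet_Ioi fun x hx => ?_
    simp only [abs_of_pos (Set.mem_Ioi.1 hx), smul_eq_mul, Complex.ofReal_exp]
    rw [← Complex.exp_add]
    congr 1
    push_cast
    ring
  rw [h1, h2, integral_exp_mul_complex_Iic (by simp; positivity),
    integral_exp_mul_complex_Ioi (by simp; positivity)]
  have hA : (τ - r * Complex.I : ℂ) ≠ 0 := fun h => hτ.ne' (by simpa using congrArg Complex.re h)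
  have hB : (τ + r * Complex.I : ℂ) ≠ 0 := fun h => hτ.ne' (by simpa using congrArg Complex.re h)
  have hC : (r ^ 2 + τ ^ 2 : ℂ) = (τ - r * Complex.I) * (τ + r * Complex.I) := by
    linear_combination (r : ℂ) ^ 2 * Complex.I_sq
  have hP : (Real.pi : ℂ) ≠ 0 := by exact_mod_cast hpi.ne'
  push_cast
  rw [hC]
  simp only [mul_zero, Complex.exp_zero]
  field_simp
  ring

open FourierTransform in
theorem integral_cos_mul_div_sq_add_sq {τ : ℝ} (hτ : 0 < τ) (a : ℝ) :
    ∫ r : ℝ, Real.cos (a * r) / (r ^ 2 + τ ^ 2) = Real.pi / τ * Real.exp (-(τ * |a|)) := by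
  have hpi := Real.pi_pos
  have hint := integrable_exp_neg_mul_abs (c := 2 * Real.pi * τ) (by positivity)
  have hF : 𝓕 (fun x : ℝ => (Real.exp (-(2 * Real.pi * τ * |x|)) : ℂ))
      = fun r : ℝ => ((τ / (Real.pi * (r ^ 2 + τ ^ 2)) : ℝ) : ℂ) :=
    funext (fourier_exp_neg_mul_abs hτ)
  have hFr : Integrable fun r : ℝ => τ / (Real.pi * (r ^ 2 + τ ^ 2)) := by
    refine ((integrable_inv_sq_add_sq hτ).const_mul (τ / Real.pi)).congr
      (Filter.Eventually.of_forall fun r => ?_)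
    simp only [div_eq_mul_inv, mul_inv, mul_assoc]
  have hFi : Integrable fun r : ℝ => ((τ / (Real.pi * (r ^ 2 + τ ^ 2)) : ℝ) : ℂ) := hFr.ofReal
  have key := congrFun (Continuous.fourierInv_fourier_eq (by fun_prop) hint (by rwa [hF]))
    (a / (2 * Real.pi))
  rw [hF, Real.fourierInv_eq'] at key
  have hint' : Integrable fun r : ℝ =>
      Complex.exp (↑(2 * Real.pi * inner ℝ r (a / (2 * Real.pi))) * Complex.I) •
        ((τ / (Real.pi * (r ^ 2 + τ ^ 2)) : ℝ) : ℂ) := by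
    refine hFi.norm.mono' (Measurable.aestronglyMeasurable (by fun_prop))
      (Filter.Eventually.of_forall fun x => ?_)
    rw [norm_smul, Complex.norm_exp_ofReal_mul_I, one_mul]
  have key' := congrArg Complex.re key
  rw [← RCLike.re_to_complex, ← integral_re hint', Complex.ofReal_re] at key'
  have hL : ∀ r : ℝ, RCLike.re (Complex.exp
      (↑(2 * Real.pi * inner ℝ r (a / (2 * Real.pi))) * Complex.I) •
        ((τ / (Real.pi * (r ^ 2 + τ ^ 2)) : ℝ) : ℂ))
      = τ / Real.pi * (Real.cos (a * r) / (r ^ 2 + τ ^ 2)) := by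
    intro r
    have h : 2 * Real.pi * inner ℝ r (a / (2 * Real.pi)) = a * r := by
      simp only [RCLike.inner_apply, conj_trivial]
      field_simp
    rw [h, smul_eq_mul, RCLike.re_to_complex, Complex.re_mul_ofReal, Complex.exp_ofReal_mul_I_re]
    field_simp
  simp_rw [hL] at key'
  rw [integral_const_mul, abs_div, abs_of_pos (by positivity : 0 < 2 * Real.pi)] at key'
  have hE : 2 * Real.pi * τ * (|a| / (2 * Real.pi)) = τ * |a| := by field_simp
  rw [hE] at key'
  rw [← key']
  field_simp

theorem integral_sin_mul_sin_div_sq_add_sq {τ d s : ℝ} (hτ : 0 < τ) (hd : 0 ≤ d) (hs : d ≤ s) :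
    ∫ r : ℝ, Real.sin (r * s) * Real.sin (d * r) / (r ^ 2 + τ ^ 2)
      = Real.pi / τ * Real.exp (-(s * τ)) * Real.sinh (d * τ) := by
  have h : ∀ r : ℝ, Real.sin (r * s) * Real.sin (d * r) / (r ^ 2 + τ ^ 2)
      = 1 / 2 * (Real.cos ((s - d) * r) / (r ^ 2 + τ ^ 2)
        - Real.cos ((s + d) * r) / (r ^ 2 + τ ^ 2)) := by
    intro r
    rw [sub_mul, add_mul, Real.cos_sub, Real.cos_add, mul_comm r s]
    ring
  simp_rw [h]
  rw [integral_const_mul, integral_sub (integrable_cos_mul_div_sq_add_sq hτ _)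
    (integrable_cos_mul_div_sq_add_sq hτ _), integral_cos_mul_div_sq_add_sq hτ,
    integral_cos_mul_div_sq_add_sq hτ, abs_of_nonneg (sub_nonneg.2 hs),
    abs_of_nonneg (by linarith), Real.sinh_eq,
    show -(τ * (s - d)) = -(s * τ) + d * τ by ring,
    show -(τ * (s + d)) = -(s * τ) + -(d * τ) by ring, Real.exp_add, Real.exp_add]
  ring

theorem integral_intervalIntegral_mul_sin_mul_sin_div {w : ℝ → ℝ} (hw : Continuous w)
    {R₁ R₂ τ d : ℝ} (hR : R₁ ≤ R₂) (hτ : 0 < τ) (hd0 : 0 ≤ d) (hd : d ≤ R₁) :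
    ∫ r : ℝ, (∫ s in R₁..R₂, w s * Real.sin (r * s)) * Real.sin (d * r) / (r ^ 2 + τ ^ 2)
      = Real.pi / τ * (∫ s in R₁..R₂, w s * Real.exp (-(s * τ))) * Real.sinh (d * τ) := by
  have hprod : Integrable (Function.uncurry fun s r : ℝ =>
      w s * Real.sin (r * s) * Real.sin (d * r) / (r ^ 2 + τ ^ 2))
      ((volume.restrict (Set.uIoc R₁ R₂)).prod volume) := by
    have hwi : Integrable w (volume.restrict (Set.uIoc R₁ R₂)) :=
      (hw.intervalIntegrable R₁ R₂).def'
    refine (hwi.norm.mul_prod (integrable_inv_sq_add_sq hτ)).mono'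
      (Measurable.aestronglyMeasurable ?_) (Filter.Eventually.of_forall fun p => ?_)
    · have := hw.measurable
      unfold Function.uncurry
      fun_prop
    · have h : 0 < p.2 ^ 2 + τ ^ 2 := by positivity
      simp only [Function.uncurry]
      rw [norm_div, norm_mul, norm_mul, Real.norm_of_nonneg h.le, div_eq_mul_inv]
      gcongr
      rw [mul_assoc]
      exact mul_le_of_le_one_right (norm_nonneg _)
        (mul_le_one₀ (Real.abs_sin_le_one _) (norm_nonneg _) (Real.abs_sin_le_one _))
  have hpull : ∀ r : ℝ,
      (∫ s in R₁..R₂, w s * Real.sin (r * s)) * Real.sin (d * r) / (r ^ 2 + τ ^ 2)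
      = ∫ s in R₁..R₂, w s * Real.sin (r * s) * Real.sin (d * r) / (r ^ 2 + τ ^ 2) := by
    intro r
    rw [intervalIntegral.integral_div, intervalIntegral.integral_mul_const]
  simp_rw [hpull]
  rw [← intervalIntegral_integral_swap hprod, ← intervalIntegral.integral_const_mul,
    ← intervalIntegral.integral_mul_const]
  refine intervalIntegral.integral_congr fun s hs => ?_
  rw [Set.uIcc_of_le hR] at hs
  simp_rw [mul_assoc (w s), mul_div_assoc (w s)]
  rw [integral_const_mul, integral_sin_mul_sin_div_sq_add_sq hτ hd0 (hd.trans hs.1)]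
  ring

theorem stmt_8 (m : ℕ) (hm : 1 ≤ m) (R₁ R₂ τ d : ℝ)
    (hR₁ : 0 < R₁) (hR : R₁ < R₂) (hτ : 0 < τ) (hd0 : 0 < d) (hd : d < R₁) :
    (∫ r : ℝ, Bfun m R₁ R₂ r * Real.sin (d * r) / (r ^ 2 + τ ^ 2))
      = Real.pi * bCoef m R₁ R₂ τ * Real.sinh (d * τ) := by
  unfold Bfun bCoef
  rw [integral_intervalIntegral_mul_sin_mul_sin_div
    (w := fun s => s * (R₂ ^ 2 - s ^ 2) ^ m * (R₁ ^ 2 - s ^ 2) ^ m)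
    (by fun_prop) hR.le hτ hd0.le hd.le]
  ring
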